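/- arXiv:1905.03463 — 3 statements merged into one kernel-verified Lean document; each statement's English description precedes it below -/
import Mathlib

section
/- Let μ̃ ∈ ℝ, σ > 0, and let Υ be a Borel measure on ℝ supported on (−∞,0) with ∫ min{1, y²} Υ(dy) < ∞, and define ψ'(s) = μ̃ + σ² s + ∫_{(−∞,0)} (y e^{sy} − y·1(y > −1)) Υ(dy) for s > 0. Then for every c > 0, lim_{s→∞} ψ'(cs)/ψ'(s) = c; that is, |ψ'| varies regularly at infinity with exponent 1. -/
open MeasureTheory Real Filter

/-- With `(μ̃, σ, Υ)` as in the Lévy–Khintchine formula (`Υ` supported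
on `(−∞,0)`, `∫ min{1, y²} dΥ < ∞`), `σ > 0`, and `ψ'` the derivative of the Laplace
exponent, for every `c > 0` one has `ψ'(cs)/ψ'(s) → c` as `s → ∞`; that is, `|ψ'|`
varies regularly at infinity with exponent 1. -/
theorem stmt_4 (μt σ : ℝ) (hσ : 0 < σ) (Υ : Measure ℝ)
    (hsupp : Υ (Set.Ici 0) = 0)
    (hΥ : Integrable (fun y : ℝ => min 1 (y ^ 2)) Υ)
    (ψ' : ℝ → ℝ)
    (hψ' : ∀ s : ℝ, 0 < s → ψ' s =
      μt + σ ^ 2 * s +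
        ∫ y, (y * Real.exp (s * y) - y * (if -1 < y then 1 else 0)) ∂Υ) :
    ∀ c : ℝ, 0 < c →
      Tendsto (fun s : ℝ => ψ' (c * s) / ψ' s) atTop (nhds c) := by
  have key : Tendsto (fun s : ℝ => ∫ y, (y * Real.exp (s * y) - y * (if -1 < y then 1 else 0)) / s ∂Υ)
      atTop (nhds (∫ _y : ℝ, (0 : ℝ) ∂Υ)) := by
    have hneg : ∀ᵐ y ∂Υ, y < 0 := by
      rw [ae_iff]
      simpa [Set.Ici] using hsupp
    refine tendsto_integral_filter_of_dominated_convergence (fun y : ℝ => min 1 (y ^ 2)) ?_ ?_ hΥ ?_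
    · refine Eventually.of_forall fun s => ?_
      have h1 : Measurable (fun y : ℝ => if -1 < y then (1 : ℝ) else 0) :=
        Measurable.ite measurableSet_Ioi measurable_const measurable_const
      apply Measurable.aestronglyMeasurable
      fun_prop
    · filter_upwards [eventually_ge_atTop (1 : ℝ)] with s hs
      filter_upwards [hneg] with y hy
      have hs0 : 0 < s := by linarith
      have he := Real.exp_pos (s * y)
      have he1 : Real.exp (s * y) ≤ 1 := Real.exp_le_one_iff.mpr (by nlinarith)
      have he2 := Real.add_one_le_exp (s * y)
      rw [Real.norm_eq_abs, abs_div, abs_of_pos hs0, div_le_iff₀ hs0]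
      split_ifs with h
      · have hm : min 1 (y ^ 2) = y ^ 2 := min_eq_right (by nlinarith)
        rw [hm, abs_le]
        constructor
        · nlinarith [mul_nonneg (neg_nonneg.mpr hy.le) (sub_nonneg.mpr he1), mul_nonneg (sq_nonneg y) hs0.le]
        · nlinarith [mul_nonneg (neg_nonneg.mpr hy.le) (sub_nonneg.mpr he2)]
      · have hm : min 1 (y ^ 2) = 1 := min_eq_left (by nlinarith)
        have he3 := Real.add_one_le_exp (-(s * y))
        have he4 : Real.exp (-(s * y)) * Real.exp (s * y) = 1 := by
          rw [← Real.exp_add]; simp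
        have h5 : (-(s * y)) * Real.exp (s * y) ≤ 1 := by
          nlinarith
        have h6 : -y * Real.exp (s * y) ≤ -(s * y) * Real.exp (s * y) :=
          mul_le_mul_of_nonneg_right (by nlinarith) he.le
        rw [hm, abs_le]
        constructor
        · linarith
        · nlinarith
    · filter_upwards [hneg] with y hy
      have ht : Tendsto (fun s : ℝ => (2 * |y|) / s) atTop (nhds 0) :=
        tendsto_const_nhds.div_atTop tendsto_id
      refine squeeze_zero_norm' ?_ ht
      filter_upwards [eventually_ge_atTop (1 : ℝ)] with s hs
      have hs0 : 0 < s := by linarith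
      have he := Real.exp_pos (s * y)
      have he1 : Real.exp (s * y) ≤ 1 := Real.exp_le_one_iff.mpr (by nlinarith)
      rw [Real.norm_eq_abs, abs_div, abs_of_pos hs0]
      gcongr
      rw [abs_of_neg hy, abs_le]
      split_ifs
      · constructor <;> nlinarith
      · constructor <;> nlinarith
  have h2 : Tendsto (fun s : ℝ => ψ' s / s) atTop (nhds (σ ^ 2)) := by
    have h3 : Tendsto (fun s : ℝ => μt / s) atTop (nhds 0) :=
      tendsto_const_nhds.div_atTop tendsto_id
    have h4 := (h3.add (tendsto_const_nhds (x := σ ^ 2))).add key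
    simp only [integral_zero, zero_add, add_zero] at h4
    refine h4.congr' ?_
    filter_upwards [eventually_gt_atTop (0 : ℝ)] with s hs
    rw [hψ' s hs, integral_div]
    field_simp
  intro c hc
  have h5 : Tendsto (fun s : ℝ => ψ' (c * s) / (c * s)) atTop (nhds (σ ^ 2)) :=
    h2.comp (tendsto_id.const_mul_atTop hc)
  have hσ2 : σ ^ 2 ≠ 0 := by positivity
  have h6 := (h5.div h2 hσ2).const_mul c
  rw [div_self hσ2, mul_one] at h6
  refine h6.congr' ?_
  filter_upwards [eventually_gt_atTop (0 : ℝ)] with s hs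
  simp only [Pi.div_apply]
  by_cases h0 : ψ' s = 0
  · simp [h0]
  · field_simp
end

section
/- Let μ ∈ ℝ, σ > 0, and y > 0, and define the inverse Gaussian density f_BM(t) = (y/(σ√(2π t³))) exp(−(y − μt)²/(2σ²t)) for t > 0. Then for every s ≥ 0, ∫₀^∞ e^{−st} f_BM(t) dt = exp(−y (√(μ² + 2σ²s) − μ)/σ²), i.e., the Laplace transform of the (possibly defective) inverse Gaussian density equals exp(−Λ_BM(s) y) with Λ_BM(s) = (√(μ² + 2σ²s) − μ)/σ². -/
open MeasureTheory Real

open Filter Topology Set in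
lemma aux_G : ∃ G : ℝ → ℝ, (∀ x, HasDerivAt G (exp (-x^2/2)) x) ∧ G 0 = 0 ∧
    Tendsto G atTop (𝓝 (√(2*π)/2)) ∧ Tendsto G atBot (𝓝 (-(√(2*π)/2))) := by
  have hc : Continuous (fun u : ℝ => exp (-u^2/2)) := by fun_prop
  have hi : Integrable (fun u : ℝ => exp (-u^2/2)) := by
    have := integrable_exp_neg_mul_sq (b := 1/2) (by norm_num)
    refine this.congr (Eventually.of_forall fun u => ?_)
    simp only; congr 1; ring
  have hI : ∫ u in Ioi (0:ℝ), exp (-u^2/2) = √(2*π)/2 := by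
    have := integral_gaussian_Ioi (1/2)
    rw [show π / (1/2) = 2*π by ring] at this
    rw [← this]
    congr 1; ext u; congr 1; ring
  have htop : Tendsto (fun x => ∫ u in (0:ℝ)..x, exp (-u^2/2)) atTop (𝓝 (√(2*π)/2)) := by
    rw [← hI]
    exact intervalIntegral_tendsto_integral_Ioi 0 hi.integrableOn tendsto_id
  refine ⟨fun x => ∫ u in (0:ℝ)..x, exp (-u^2/2), fun x => ?_, by simp, htop, ?_⟩
  · exact (hc.integral_hasStrictDerivAt 0 x).hasDerivAt
  · have h2 := (htop.comp tendsto_neg_atBot_atTop).neg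
    refine h2.congr fun x => ?_
    have := intervalIntegral.integral_comp_neg (a := 0) (b := x) (fun u : ℝ => exp (-u^2/2))
    simp only [neg_sq, neg_zero] at this
    rw [this, intervalIntegral.integral_symm]; rfl

open Filter Topology Set in
lemma aux_int (p q : ℝ) (hp : 0 ≤ p) (hq : 0 < q) :
    ∫ t in Ioi (0:ℝ), exp (-(p*√t - q/√t)^2/2) * (q/(t*√t)) = √(2*π) := by
  obtain ⟨G, hG, hG0, hGt, hGb⟩ := aux_G
  set L := √(2*π)/2 with hL
  set F : ℝ → ℝ := fun t => G (p*√t - q/√t) + exp (2*p*q) * G (-(p*√t) - q/√t) with hF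
  have hGc : Continuous G := continuous_iff_continuousAt.2 fun x => (hG x).continuousAt
  have hs0 : Tendsto (fun t : ℝ => √t) (𝓝[>] 0) (𝓝[>] 0) := by
    refine tendsto_nhdsWithin_iff.2 ⟨?_, ?_⟩
    · have := (continuous_sqrt.tendsto 0).mono_left (nhdsWithin_le_nhds (s := Ioi 0))
      simpa using this
    · filter_upwards [self_mem_nhdsWithin] with t ht using sqrt_pos.2 ht
  have hs0' : Tendsto (fun t : ℝ => √t) (𝓝[>] 0) (𝓝 0) := hs0.mono_right nhdsWithin_le_nhds
  have hq0 : Tendsto (fun t : ℝ => -(q/√t)) (𝓝[>] 0) atBot := by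
    refine tendsto_neg_atTop_atBot.comp ?_
    simp only [div_eq_mul_inv]
    exact (tendsto_inv_nhdsGT_zero.comp hs0).const_mul_atTop hq
  have hqt : Tendsto (fun t : ℝ => q/√t) atTop (𝓝 0) :=
    tendsto_const_nhds.div_atTop tendsto_sqrt_atTop
  have hF0 : Tendsto F (𝓝[>] 0) (𝓝 (-L + exp (2*p*q) * (-L))) := by
    refine Tendsto.add (hGb.comp ?_) (Tendsto.const_mul _ (hGb.comp ?_))
    · simp only [sub_eq_add_neg]
      exact (hs0'.const_mul p).add_atBot hq0
    · simp only [sub_eq_add_neg]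
      exact (hs0'.const_mul p).neg.add_atBot hq0
  have hFt : Tendsto F atTop (𝓝 (L - exp (2*p*q) * L)) := by
    rcases hp.eq_or_lt with rfl | hp
    · have h : Tendsto F atTop (𝓝 (G (0*0-0) + exp (2*0*q) * G (0*0-0))) := by
        have : Tendsto (fun t : ℝ => (0*0 - q/√t)) atTop (𝓝 (0*0-0)) := hqt.const_sub _
        have h1 := (hGc.tendsto _).comp this
        refine (h1.add (h1.const_mul (exp (2*0*q)))).congr fun t => ?_
        simp [hF]
      simpa [hG0] using h
    · rw [sub_eq_add_neg, ← mul_neg]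
      have hpt : Tendsto (fun t : ℝ => p*√t) atTop atTop := tendsto_sqrt_atTop.const_mul_atTop hp
      refine Tendsto.add (hGt.comp ?_) (Tendsto.const_mul _ (hGb.comp ?_))
      · simp only [sub_eq_add_neg]
        exact hpt.atTop_add hqt.neg
      · simp only [sub_eq_add_neg]
        exact (tendsto_neg_atTop_atBot.comp hpt).atBot_add hqt.neg
  have hd : ∀ t ∈ Ioi (0:ℝ), HasDerivAt F (exp (-(p*√t - q/√t)^2/2) * (q/(t*√t))) t := by
    intro t ht
    have ht : 0 < t := ht
    have hr : 0 < √t := sqrt_pos.2 ht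
    have h1 := hasDerivAt_sqrt ht.ne'
    have h2 := h1.const_mul p
    have h3 := (hasDerivAt_const t q).div h1 hr.ne'
    have h4 := (hG _).comp t (h2.sub h3)
    have h5 := ((hG _).comp t (h2.neg.sub h3)).const_mul (exp (2*p*q))
    refine (h4.add h5).congr_deriv ?_
    simp only [Pi.sub_apply, Pi.neg_apply, Pi.div_apply]
    have he : exp (2*p*q) * exp (-(-(p*√t) - q/√t)^2/2) = exp (-(p*√t - q/√t)^2/2) := by
      rw [← exp_add]; congr 1; field_simp; ring
    rw [← mul_assoc, he, ← mul_add]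
    congr 1
    have hsq : t = √t^2 := (sq_sqrt ht.le).symm
    generalize √t = r at *
    subst hsq
    field_simp
    ring
  have hpos : ∀ t ∈ Ioi (0:ℝ), 0 ≤ exp (-(p*√t - q/√t)^2/2) * (q/(t*√t)) := by
    intro t ht
    have ht : 0 < t := ht
    positivity
  set H := Function.update F 0 (-L + exp (2*p*q) * (-L)) with hH
  have hHe : ∀ t : ℝ, 0 < t → H t = F t := fun t ht => Function.update_of_ne ht.ne' _ _
  have key := integral_Ioi_of_hasDerivAt_of_nonneg (g := H) (a := 0)
    (g' := fun t => exp (-(p*√t - q/√t)^2/2) * (q/(t*√t))) (l := L - exp (2*p*q) * L)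
    ?_ ?_ hpos ?_
  · rw [key, hH, Function.update_self]; simp only [hL]; ring
  · rw [hH, continuousWithinAt_update_same]
    simpa using hF0
  · intro t ht
    refine (hd t ht).congr_of_eventuallyEq ?_
    filter_upwards [Ioi_mem_nhds ht] with x hx using hHe x hx
  · refine hFt.congr' ?_
    filter_upwards [eventually_gt_atTop 0] with x hx using (hHe x hx).symm

/-- The Laplace transform of the (possibly defective) inverse Gaussian
density `f_BM(t) = (y/(σ√(2πt³))) exp(−(y − μt)²/(2σ²t))` equals
`exp(−Λ_BM(s) y)` with `Λ_BM(s) = (√(μ² + 2σ²s) − μ)/σ²`, for every `s ≥ 0`. -/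
theorem stmt_8 (μ σ y : ℝ) (hσ : 0 < σ) (hy : 0 < y)
    (fBM : ℝ → ℝ)
    (hf : ∀ t : ℝ, 0 < t → fBM t =
      y / (σ * Real.sqrt (2 * Real.pi * t ^ 3)) *
        Real.exp (-(y - μ * t) ^ 2 / (2 * σ ^ 2 * t))) :
    ∀ s : ℝ, 0 ≤ s →
      ∫ t in Set.Ioi (0 : ℝ), Real.exp (-s * t) * fBM t =
        Real.exp (-y * (Real.sqrt (μ ^ 2 + 2 * σ ^ 2 * s) - μ) / σ ^ 2) := by
  intro s hs
  set m := √(μ ^ 2 + 2 * σ ^ 2 * s) with hm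
  have hm0 : 0 ≤ m := sqrt_nonneg _
  have hm2 : m^2 = μ ^ 2 + 2 * σ ^ 2 * s := sq_sqrt (by positivity)
  have key := aux_int (m/σ) (y/σ) (by positivity) (by positivity)
  have hpi : 0 < √(2*π) := by positivity
  have : ∀ t ∈ Set.Ioi (0:ℝ), exp (-s * t) * fBM t =
      (exp (-y * (m - μ) / σ ^ 2) / √(2*π)) *
        (exp (-(m/σ*√t - y/σ/√t)^2/2) * (y/σ/(t*√t))) := by
    intro t ht
    have ht : 0 < t := ht
    have hr : 0 < √t := sqrt_pos.2 ht
    rw [hf t ht]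
    have h3 : √(2*π*t^3) = √(2*π) * (t * √t) := by
      rw [sqrt_mul (by positivity)]
      congr 1
      rw [show t^3 = t^2*t by ring, sqrt_mul (by positivity), sqrt_sq ht.le]
    have he : exp (-s*t) * exp (-(y - μ * t) ^ 2 / (2 * σ ^ 2 * t)) =
        exp (-y * (m - μ) / σ ^ 2) * exp (-(m/σ*√t - y/σ/√t)^2/2) := by
      rw [← exp_add, ← exp_add]
      congr 1
      have hsq : t = √t^2 := (sq_sqrt ht.le).symm
      generalize √t = r at *
      subst hsq
      field_simp
      linear_combination (r^4) * hm2
    rw [h3]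
    calc _ = (exp (-s*t) * exp (-(y - μ * t) ^ 2 / (2 * σ ^ 2 * t))) *
          (y / (σ * (√(2*π) * (t * √t)))) := by ring
      _ = _ := by rw [he]; field_simp
  rw [setIntegral_congr_fun measurableSet_Ioi this, integral_const_mul, key]
  field_simp
end

section
/- Let μ ∈ ℝ, σ > 0, and y > 0. Define, for t > 0, f_BM(t) = (y/(σ√(2π t³))) exp(−(y − μt)²/(2σ²t)) and F̄_BM(t) = Φ((y − μt)/(σ√t)) − exp(2μy/σ²) Φ(−(y + μt)/(σ√t)), where Φ is the standard normal cumulative distribution function. Then F̄_BM is differentiable at every t > 0 with derivative F̄_BM'(t) = −f_BM(t). -/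
open MeasureTheory Real

lemma Phi_hasDerivAt (Φ : ℝ → ℝ)
    (hΦ : ∀ x : ℝ, Φ x =
      ∫ t in Set.Iic x, (Real.sqrt (2 * Real.pi))⁻¹ * Real.exp (-t ^ 2 / 2)) (x : ℝ) :
    HasDerivAt Φ ((Real.sqrt (2 * Real.pi))⁻¹ * Real.exp (-x ^ 2 / 2)) x := by
  have hi : Integrable (fun t : ℝ => (Real.sqrt (2 * Real.pi))⁻¹ * Real.exp (-t ^ 2 / 2)) := by
    have h := (integrable_exp_neg_mul_sq (b := 1 / 2) (by norm_num)).const_mul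
      (Real.sqrt (2 * Real.pi))⁻¹
    refine h.congr (Filter.Eventually.of_forall fun t => ?_)
    simp only
    congr 2
    ring
  have hc : Continuous (fun t : ℝ => (Real.sqrt (2 * Real.pi))⁻¹ * Real.exp (-t ^ 2 / 2)) := by
    fun_prop
  have h1 := intervalIntegral.integral_hasDerivAt_right (a := 0) (b := x)
    hi.intervalIntegrable (hc.stronglyMeasurableAtFilter _ _) hc.continuousAt
  have h2 := h1.const_add (Φ 0)
  refine h2.congr_of_eventuallyEq (Filter.Eventually.of_forall fun z => ?_)
  simp only
  rw [← intervalIntegral.integral_Iic_sub_Iic hi.integrableOn hi.integrableOn, hΦ z, hΦ 0]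
  ring

/-- The inverse Gaussian survival function
`F̄_BM(t) = Φ((y − μt)/(σ√t)) − exp(2μy/σ²) Φ(−(y + μt)/(σ√t))` is differentiable at
every `t > 0`, with derivative `−f_BM(t)`, where `f_BM` is the inverse Gaussian
density and `Φ` the standard normal CDF. -/
theorem stmt_10 (μ σ y : ℝ) (hσ : 0 < σ) (hy : 0 < y)
    (Φ : ℝ → ℝ)
    (hΦ : ∀ x : ℝ, Φ x =
      ∫ t in Set.Iic x, (Real.sqrt (2 * Real.pi))⁻¹ * Real.exp (-t ^ 2 / 2))
    (fBM Fbar : ℝ → ℝ)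
    (hf : ∀ t : ℝ, 0 < t → fBM t =
      y / (σ * Real.sqrt (2 * Real.pi * t ^ 3)) *
        Real.exp (-(y - μ * t) ^ 2 / (2 * σ ^ 2 * t)))
    (hFbar : ∀ t : ℝ, 0 < t → Fbar t =
      Φ ((y - μ * t) / (σ * Real.sqrt t)) -
        Real.exp (2 * μ * y / σ ^ 2) * Φ (-(y + μ * t) / (σ * Real.sqrt t))) :
    ∀ t : ℝ, 0 < t → HasDerivAt Fbar (-fBM t) t := by
  intro t ht
  have hs : 0 < Real.sqrt t := Real.sqrt_pos.2 ht
  have hsq : HasDerivAt Real.sqrt (1 / (2 * Real.sqrt t)) t := Real.hasDerivAt_sqrt ht.ne'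
  have hne : σ * Real.sqrt t ≠ 0 := by positivity
  have hlin : HasDerivAt (fun t : ℝ => μ * t) μ t := by
    simpa using (hasDerivAt_id t).const_mul μ
  have ha := (hlin.const_sub y).div (hsq.const_mul σ) hne
  have hb := (hlin.const_add y).neg.div (hsq.const_mul σ) hne
  have hA := (Phi_hasDerivAt Φ hΦ ((y - μ * t) / (σ * Real.sqrt t))).comp t ha
  have hB := ((Phi_hasDerivAt Φ hΦ (-(y + μ * t) / (σ * Real.sqrt t))).comp t hb).const_mul
    (Real.exp (2 * μ * y / σ ^ 2))
  have hD := (hA.sub hB).congr_of_eventuallyEq (f₁ := Fbar) (by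
    filter_upwards [lt_mem_nhds ht] with z hz
    simpa using hFbar z hz)
  refine hD.congr_deriv (Eq.symm ?_)
  simp only [Pi.neg_apply]
  rw [hf t ht]
  have hp : 0 < Real.sqrt (2 * Real.pi) := by positivity
  have hr : Real.sqrt (2 * Real.pi * t ^ 3) = Real.sqrt (2 * Real.pi) * Real.sqrt t ^ 3 := by
    rw [Real.sqrt_mul (by positivity)]
    congr 1
    rw [Real.sqrt_eq_iff_mul_self_eq (by positivity) (by positivity)]
    symm
    calc Real.sqrt t ^ 3 * Real.sqrt t ^ 3 = (Real.sqrt t ^ 2) ^ 3 := by ring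
      _ = t ^ 3 := by rw [Real.sq_sqrt ht.le]
  have hts : t = Real.sqrt t ^ 2 := (Real.sq_sqrt ht.le).symm
  rw [hr]
  have e1 : -((y - μ * t) / (σ * Real.sqrt t)) ^ 2 / 2
      = -(y - μ * t) ^ 2 / (2 * σ ^ 2 * t) := by
    rw [div_pow, mul_pow, Real.sq_sqrt ht.le]
    field_simp
  have e2 : Real.exp (-(-(y + μ * t) / (σ * Real.sqrt t)) ^ 2 / 2) * Real.exp (2 * μ * y / σ ^ 2)
      = Real.exp (-(y - μ * t) ^ 2 / (2 * σ ^ 2 * t)) := by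
    rw [← Real.exp_add, div_pow, mul_pow, Real.sq_sqrt ht.le]
    congr 1
    field_simp
    ring
  rw [e1]
  have e3 : ∀ c d : ℝ, Real.exp (2 * μ * y / σ ^ 2) *
      (c * Real.exp (-(-(y + μ * t) / (σ * Real.sqrt t)) ^ 2 / 2) * d)
      = c * Real.exp (-(y - μ * t) ^ 2 / (2 * σ ^ 2 * t)) * d := by
    intro c d
    rw [← e2]
    ring
  rw [e3]
  generalize Real.exp (-(y - μ * t) ^ 2 / (2 * σ ^ 2 * t)) = E
  clear hD hA hB ha hb hsq hlin hf hFbar hΦ hr e1 e2 e3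
  generalize Real.sqrt (2 * Real.pi) = P at *
  generalize Real.sqrt t = s at *
  subst hts
  field_simp
  ring
end
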